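/- arXiv:2405.11392 — 6 statements merged into one kernel-verified Lean document; each statement's English description precedes it below -/
import Mathlib

section
/- Let (Y^1_i)_{i=0,…,N} and (Y^2_i)_{i=0,…,N} be integrable real-valued processes adapted to (ℱ_i), and let (f_i)_{i=0,…,N−1} be integrable with each f_i ℱ_i-measurable. Suppose that for k = 1, 2 and every i = 0, 1, …, N−1, Y^k_i = E[Y^k_{i+1} | ℱ_i] + (f_i + λ(−Y^k_i)^+)·h almost surely. Then sup_{0 ≤ i ≤ N} E|Y^1_i − Y^2_i| ≤ E|Y^1_N − Y^2_N|. -/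
open MeasureTheory

/-- An implicit step `y = c + k * y⁻ + g` with `k ≥ 0` is nonexpansive in `c`. -/
lemma abs_sub_le_of_eq_add_mul_negPart {y₁ y₂ c₁ c₂ g k : ℝ} (hk : 0 ≤ k)
    (h₁ : y₁ = c₁ + k * max (-y₁) 0 + g) (h₂ : y₂ = c₂ + k * max (-y₂) 0 + g) :
    |y₁ - y₂| ≤ |c₁ - c₂| := by
  rcases le_total y₁ y₂ with h | h
  · have hm : max (-y₂) 0 ≤ max (-y₁) 0 := max_le_max_right 0 (neg_le_neg h)
    rw [abs_of_nonpos (sub_nonpos.2 h)]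
    refine le_trans ?_ (neg_le_abs (c₁ - c₂))
    nlinarith [mul_le_mul_of_nonneg_left hm hk]
  · have hm : max (-y₁) 0 ≤ max (-y₂) 0 := max_le_max_right 0 (neg_le_neg h)
    rw [abs_of_nonneg (sub_nonneg.2 h)]
    refine le_trans ?_ (le_abs_self (c₁ - c₂))
    nlinarith [mul_le_mul_of_nonneg_left hm hk]

/-- Lemma 2 in the paper: Let `(Y¹ᵢ)` and `(Y²ᵢ)` (i = 0,…,N) be integrable
real-valued processes adapted to a filtration `(ℱᵢ)`, and let `(fᵢ)` (i = 0,…,N−1) be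
integrable with each `fᵢ` ℱᵢ-measurable.  Suppose that for k = 1, 2 and every i < N,
`Yᵏᵢ = E[Yᵏᵢ₊₁ | ℱᵢ] + (fᵢ + λ(−Yᵏᵢ)⁺)·h` almost surely.  Then
`sup_{0 ≤ i ≤ N} E|Y¹ᵢ − Y²ᵢ| ≤ E|Y¹_N − Y²_N|`. -/
theorem discrete_penalized_scheme_contraction
    {Ω : Type*} {mΩ : MeasurableSpace Ω} {μ : Measure Ω} [IsProbabilityMeasure μ]
    (N : ℕ) (ℱ : Filtration ℕ mΩ) (hstep lam : ℝ) (hh : 0 < hstep) (hlam : 0 ≤ lam)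
    (Y1 Y2 f : ℕ → Ω → ℝ)
    (hY1adapt : ∀ i ≤ N, StronglyMeasurable[ℱ i] (Y1 i))
    (hY2adapt : ∀ i ≤ N, StronglyMeasurable[ℱ i] (Y2 i))
    (hfmeas : ∀ i < N, StronglyMeasurable[ℱ i] (f i))
    (hY1int : ∀ i ≤ N, Integrable (Y1 i) μ)
    (hY2int : ∀ i ≤ N, Integrable (Y2 i) μ)
    (hfint : ∀ i < N, Integrable (f i) μ)
    (hY1 : ∀ i < N, Y1 i =ᵐ[μ]
      fun ω => (μ[Y1 (i + 1)|ℱ i]) ω + (f i ω + lam * max (-(Y1 i ω)) 0) * hstep)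
    (hY2 : ∀ i < N, Y2 i =ᵐ[μ]
      fun ω => (μ[Y2 (i + 1)|ℱ i]) ω + (f i ω + lam * max (-(Y2 i ω)) 0) * hstep) :
    ∀ i ≤ N, ∫ ω, |Y1 i ω - Y2 i ω| ∂μ ≤ ∫ ω, |Y1 N ω - Y2 N ω| ∂μ := by
  have step : ∀ i < N,
      ∫ ω, |Y1 i ω - Y2 i ω| ∂μ ≤ ∫ ω, |Y1 (i + 1) ω - Y2 (i + 1) ω| ∂μ := by
    intro i hi
    have hpt : ∀ᵐ ω ∂μ,
        |Y1 i ω - Y2 i ω| ≤ |(μ[Y1 (i + 1) - Y2 (i + 1)|ℱ i]) ω| := by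
      filter_upwards [hY1 i hi, hY2 i hi,
        condExp_sub (hY1int (i + 1) hi) (hY2int (i + 1) hi) (ℱ i)] with ω h₁ h₂ hsub
      rw [hsub, Pi.sub_apply]
      exact abs_sub_le_of_eq_add_mul_negPart (g := f i ω * hstep)
        (mul_nonneg hlam hh.le) (h₁.trans (by ring)) (h₂.trans (by ring))
    calc ∫ ω, |Y1 i ω - Y2 i ω| ∂μ
        ≤ ∫ ω, |(μ[Y1 (i + 1) - Y2 (i + 1)|ℱ i]) ω| ∂μ :=
          integral_mono_ae ((hY1int i hi.le).sub (hY2int i hi.le)).abs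
            integrable_condExp.abs hpt
      _ ≤ ∫ ω, |Y1 (i + 1) ω - Y2 (i + 1) ω| ∂μ := integral_abs_condExp_le _
  intro i hi
  induction hi using Nat.decreasingInduction with
  | self => exact le_rfl
  | of_succ k hk ih => exact (step k hk).trans ih
end

section
/- Let (Y_i)_{i=0,…,N} and (Y'_i)_{i=0,…,N} be integrable real-valued processes adapted to (ℱ_i), let (φ_i)_{i=0,…,N−1}, (ψ_i)_{i=0,…,N−1} and (e_i)_{i=0,…,N−1} be integrable real-valued random variables, and suppose that for every i = 0, 1, …, N−1, almost surely Y_i = E[Y_{i+1} | ℱ_i] + (φ_i + λ(−Y_i)^+)·h + e_i and Y'_i = E[Y'_{i+1} | ℱ_i] + (ψ_i + λ(−Y'_i)^+)·h. Then for every i = 0, 1, …, N, E|Y_i − Y'_i| ≤ E|Y_N − Y'_N| + h·Σ_{j=i}^{N−1} E|φ_j − ψ_j| + Σ_{j=i}^{N−1} E|e_j|. -/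
open MeasureTheory

/-- Adding a nonnegative multiple of the nonincreasing penalty `x ↦ (-x)⁺` to the right-hand side
does not increase distances. -/
theorem abs_sub_le_of_eq_add_mul_negPart_s4 {a b k r s : ℝ} (hk : 0 ≤ k)
    (ha : a = r + k * max (-a) 0) (hb : b = s + k * max (-b) 0) :
    |a - b| ≤ |r - s| := by
  rcases le_total a b with hab | hab
  · have h := mul_le_mul_of_nonneg_left
      (max_le_max_right 0 (neg_le_neg hab) : max (-b) 0 ≤ max (-a) 0) hk
    rw [abs_of_nonpos (by linarith)]
    exact le_trans (by linarith) (neg_le_abs (r - s))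
  · have h := mul_le_mul_of_nonneg_left
      (max_le_max_right 0 (neg_le_neg hab) : max (-a) 0 ≤ max (-b) 0) hk
    rw [abs_of_nonneg (by linarith)]
    exact le_trans (by linarith) (le_abs_self (r - s))

/-- One backward step of the stability estimate for the penalized scheme. -/
theorem integral_abs_sub_le_of_penalized_step
    {Ω : Type*} {m mΩ : MeasurableSpace Ω} {μ : Measure Ω} {hstep lam : ℝ}
    (hh : 0 ≤ hstep) (hlam : 0 ≤ lam) {Y Y' Z Z' φ ψ e : Ω → ℝ}
    (hZ : Integrable Z μ) (hZ' : Integrable Z' μ)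
    (hφ : Integrable φ μ) (hψ : Integrable ψ μ) (he : Integrable e μ)
    (hYeq : Y =ᵐ[μ] fun ω => (μ[Z|m]) ω + (φ ω + lam * max (-(Y ω)) 0) * hstep + e ω)
    (hY'eq : Y' =ᵐ[μ] fun ω => (μ[Z'|m]) ω + (ψ ω + lam * max (-(Y' ω)) 0) * hstep) :
    ∫ ω, |Y ω - Y' ω| ∂μ ≤
      ∫ ω, |Z ω - Z' ω| ∂μ + hstep * ∫ ω, |φ ω - ψ ω| ∂μ + ∫ ω, |e ω| ∂μ := by
  have hc : Integrable (fun ω => |(μ[Z - Z'|m]) ω|) μ := integrable_condExp.abs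
  have hd : Integrable (fun ω => hstep * |φ ω - ψ ω|) μ := (hφ.sub hψ).abs.const_mul hstep
  have hbound : ∀ᵐ ω ∂μ, |Y ω - Y' ω| ≤
      |(μ[Z - Z'|m]) ω| + hstep * |φ ω - ψ ω| + |e ω| := by
    filter_upwards [hYeq, hY'eq, condExp_sub hZ hZ' m] with ω h h' hsub
    rw [Pi.sub_apply] at hsub
    have key := abs_sub_le_of_eq_add_mul_negPart_s4 (mul_nonneg hlam hh)
      (r := (μ[Z|m]) ω + φ ω * hstep + e ω) (s := (μ[Z'|m]) ω + ψ ω * hstep)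
      (a := Y ω) (b := Y' ω) (by linarith) (by linarith)
    have hsplit : (μ[Z|m]) ω + φ ω * hstep + e ω - ((μ[Z'|m]) ω + ψ ω * hstep) =
        (μ[Z - Z'|m]) ω + hstep * (φ ω - ψ ω) + e ω := by
      rw [hsub]; ring
    rw [hsplit] at key
    refine key.trans ((abs_add_three _ _ _).trans_eq ?_)
    rw [abs_mul, abs_of_nonneg hh]
  calc ∫ ω, |Y ω - Y' ω| ∂μ
      ≤ ∫ ω, (|(μ[Z - Z'|m]) ω| + hstep * |φ ω - ψ ω| + |e ω|) ∂μ :=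
        integral_mono_of_nonneg (ae_of_all _ fun _ => abs_nonneg _)
          ((hc.add hd).add he.abs) hbound
    _ = ∫ ω, |(μ[Z - Z'|m]) ω| ∂μ + hstep * ∫ ω, |φ ω - ψ ω| ∂μ + ∫ ω, |e ω| ∂μ := by
        have hcd : Integrable (fun ω => |(μ[Z - Z'|m]) ω| + hstep * |φ ω - ψ ω|) μ := hc.add hd
        rw [integral_add hcd he.abs, integral_add hc hd, integral_const_mul]
    _ ≤ _ :=
        add_le_add_left (add_le_add_left (integral_abs_condExp_le (Z - Z')) _) _

/-- Let `(Yᵢ)` and `(Y'ᵢ)` (i = 0,…,N) be integrable real-valued processes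
adapted to `(ℱᵢ)`, let `(φᵢ)`, `(ψᵢ)`, `(eᵢ)` (i = 0,…,N−1) be integrable real-valued
random variables, and suppose that for every i < N, almost surely
`Yᵢ = E[Yᵢ₊₁ | ℱᵢ] + (φᵢ + λ(−Yᵢ)⁺)·h + eᵢ` and
`Y'ᵢ = E[Y'ᵢ₊₁ | ℱᵢ] + (ψᵢ + λ(−Y'ᵢ)⁺)·h`.  Then for every i ≤ N,
`E|Yᵢ − Y'ᵢ| ≤ E|Y_N − Y'_N| + h·Σ_{j=i}^{N−1} E|φⱼ − ψⱼ| + Σ_{j=i}^{N−1} E|eⱼ|`. -/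
theorem discrete_penalized_scheme_stability
    {Ω : Type*} {mΩ : MeasurableSpace Ω} {μ : Measure Ω} [IsProbabilityMeasure μ]
    (N : ℕ) (ℱ : Filtration ℕ mΩ) (hstep lam : ℝ) (hh : 0 < hstep) (hlam : 0 ≤ lam)
    (Y Y' φ ψ e : ℕ → Ω → ℝ)
    (hYadapt : ∀ i ≤ N, StronglyMeasurable[ℱ i] (Y i))
    (hY'adapt : ∀ i ≤ N, StronglyMeasurable[ℱ i] (Y' i))
    (hYint : ∀ i ≤ N, Integrable (Y i) μ)
    (hY'int : ∀ i ≤ N, Integrable (Y' i) μ)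
    (hφint : ∀ i < N, Integrable (φ i) μ)
    (hψint : ∀ i < N, Integrable (ψ i) μ)
    (heint : ∀ i < N, Integrable (e i) μ)
    (hY : ∀ i < N, Y i =ᵐ[μ]
      fun ω => (μ[Y (i + 1)|ℱ i]) ω + (φ i ω + lam * max (-(Y i ω)) 0) * hstep + e i ω)
    (hY' : ∀ i < N, Y' i =ᵐ[μ]
      fun ω => (μ[Y' (i + 1)|ℱ i]) ω + (ψ i ω + lam * max (-(Y' i ω)) 0) * hstep) :
    ∀ i ≤ N, ∫ ω, |Y i ω - Y' i ω| ∂μ ≤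
      ∫ ω, |Y N ω - Y' N ω| ∂μ
        + hstep * ∑ j ∈ Finset.Ico i N, ∫ ω, |φ j ω - ψ j ω| ∂μ
        + ∑ j ∈ Finset.Ico i N, ∫ ω, |e j ω| ∂μ := by
  intro i hi
  induction hi using Nat.decreasingInduction with
  | self => simp
  | of_succ i hi ih =>
    have hstep_le := integral_abs_sub_le_of_penalized_step hh.le hlam
      (hYint (i + 1) hi) (hY'int (i + 1) hi) (hφint i hi) (hψint i hi) (heint i hi)
      (hY i hi) (hY' i hi)
    rw [Finset.sum_eq_sum_Ico_succ_bot hi, Finset.sum_eq_sum_Ico_succ_bot hi, mul_add]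
    linarith
end

section
/- Let 𝒢 ⊆ ℱ be a sub-σ-algebra, α ≥ 0, and let Y, Y' be 𝒢-measurable integrable real random variables, Z, Z' integrable real random variables, and c a 𝒢-measurable integrable random variable. If Y = E[Z | 𝒢] + c + α(−Y)^+ almost surely and Y' = E[Z' | 𝒢] + c + α(−Y')^+ almost surely, then |Y − Y'| ≤ E[|Z − Z'| | 𝒢] almost surely. -/
open MeasureTheory

/-- The map `y ↦ y - α (-y)⁺` does not contract distances when `0 ≤ α`. -/
theorem abs_sub_le_of_eq_add_mul_max_neg {α a b y z : ℝ} (hα : 0 ≤ α)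
    (hy : y = a + α * max (-y) 0) (hz : z = b + α * max (-z) 0) :
    |y - z| ≤ |a - b| := by
  wlog h : z ≤ y generalizing a b y z
  · rw [abs_sub_comm y z, abs_sub_comm a b]
    exact this hz hy (le_of_not_ge h)
  have hmax : α * max (-y) 0 ≤ α * max (-z) 0 := by gcongr
  rw [abs_of_nonneg (sub_nonneg.2 h)]
  exact le_trans (by linarith) (le_abs_self _)

/-- Let 𝒢 ⊆ ℱ be a sub-σ-algebra, α ≥ 0, and let Y, Y' be 𝒢-measurable
integrable real random variables, Z, Z' integrable real random variables, and c a
𝒢-measurable integrable random variable. If `Y = E[Z | 𝒢] + c + α(−Y)⁺` a.s. and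
`Y' = E[Z' | 𝒢] + c + α(−Y')⁺` a.s., then `|Y − Y'| ≤ E[|Z − Z'| | 𝒢]` a.s. -/
theorem abs_diff_le_condexp_abs_of_implicit_penalty_eq
    {Ω : Type*} {mΩ : MeasurableSpace Ω} {μ : Measure Ω} [IsProbabilityMeasure μ]
    (𝒢 : MeasurableSpace Ω) (h𝒢 : 𝒢 ≤ mΩ) (α : ℝ) (hα : 0 ≤ α)
    (Y Y' Z Z' c : Ω → ℝ)
    (hYmeas : StronglyMeasurable[𝒢] Y) (hY'meas : StronglyMeasurable[𝒢] Y')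
    (hcmeas : StronglyMeasurable[𝒢] c)
    (hYint : Integrable Y μ) (hY'int : Integrable Y' μ)
    (hZint : Integrable Z μ) (hZ'int : Integrable Z' μ) (hcint : Integrable c μ)
    (hY : ∀ᵐ ω ∂μ, Y ω = (μ[Z|𝒢]) ω + c ω + α * max (-(Y ω)) 0)
    (hY' : ∀ᵐ ω ∂μ, Y' ω = (μ[Z'|𝒢]) ω + c ω + α * max (-(Y' ω)) 0) :
    ∀ᵐ ω ∂μ, |Y ω - Y' ω| ≤ (μ[fun ω' => |Z ω' - Z' ω'| | 𝒢]) ω := by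
  have hnorm : ∀ᵐ ω ∂μ, |(μ[Z - Z'|𝒢]) ω| ≤ (μ[fun ω' => |Z ω' - Z' ω'| | 𝒢]) ω :=
    norm_condExp_le (Z - Z')
  filter_upwards [hY, hY', condExp_sub hZint hZ'int 𝒢, hnorm] with ω h h' hsub hle
  rw [hsub, Pi.sub_apply] at hle
  refine (abs_sub_le_of_eq_add_mul_max_neg hα h h').trans ?_
  rwa [add_sub_add_right_eq_sub]
end

section
/- Let T > 0, r ≥ 0, d ∈ ℕ, and k ∈ ℕ with k ≥ 2. Suppose b_i, a_{ij} : [0,T]×ℝ^d → ℝ (i, j = 1,…,d) satisfy |b_i(t,x)| < c₁|x| + d₁ and |a_{ij}(t,x)| < c₂|x|² + d₂ for all (t,x), for some positive constants c₁, d₁, c₂, d₂. Then there exist constants a > 0 and d' > 0 such that the function Q(x) = |x|^{2k} + d' satisfies Σ_{i,j=1}^d a_{ij}(t,x) ∂²Q/∂x_i∂x_j(x) + Σ_{i=1}^d b_i(t,x) ∂Q/∂x_i(x) < (r + a)·Q(x) for all (t,x) ∈ [0,T]×ℝ^d. -/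
noncomputable section

/-- ℝ^d with the Euclidean norm. -/
abbrev Vec (d : ℕ) := EuclideanSpace ℝ (Fin d)

/-- The partial derivative `∂Q/∂x_i` of `Q : ℝ^d → ℝ`. -/
noncomputable def pd {d : ℕ} (Q : Vec d → ℝ) (i : Fin d) (x : Vec d) : ℝ :=
  fderiv ℝ Q x (EuclideanSpace.single i 1)

/-- The second partial derivative `∂²Q/∂x_i∂x_j` of `Q : ℝ^d → ℝ`. -/
noncomputable def pdd {d : ℕ} (Q : Vec d → ℝ) (i j : Fin d) (x : Vec d) : ℝ :=
  fderiv ℝ (fun y => pd Q j y) x (EuclideanSpace.single i 1)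

theorem hasFDerivAt_norm_sq_pow {d : ℕ} (n : ℕ) (x : Vec d) :
    HasFDerivAt (fun y : Vec d => (‖y‖ ^ 2) ^ (n + 1))
      (((n + 1 : ℝ) * (‖x‖ ^ 2) ^ n) • (2 • innerSL ℝ x)) x := by
  simpa using ((hasStrictFDerivAt_norm_sq x).hasFDerivAt).pow (n + 1)

theorem pd_norm_pow_add_const {d : ℕ} (n : ℕ) (c : ℝ) (i : Fin d) (x : Vec d) :
    pd (fun y : Vec d => ‖y‖ ^ (2 * (n + 1)) + c) i x
      = 2 * (n + 1) * ((‖x‖ ^ 2) ^ n * x i) := by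
  simp only [pow_mul]
  rw [pd, ((hasFDerivAt_norm_sq_pow n x).add_const c).fderiv]
  simp [EuclideanSpace.inner_single_right]
  ring

theorem pdd_norm_pow_add_const {d : ℕ} (m : ℕ) (c : ℝ) (i j : Fin d) (x : Vec d) :
    pdd (fun y : Vec d => ‖y‖ ^ (2 * (m + 2)) + c) i j x
      = 4 * (m + 2) * (m + 1) * (‖x‖ ^ 2) ^ m * (x i * x j)
        + 2 * (m + 2) * (‖x‖ ^ 2) ^ (m + 1) * (if i = j then 1 else 0) := by
  have h : (fun y : Vec d => pd (fun y : Vec d => ‖y‖ ^ (2 * (m + 2)) + c) j y)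
      = fun y => 2 * ((m + 1 : ℕ) + 1 : ℝ) * ((‖y‖ ^ 2) ^ (m + 1) * y j) :=
    funext fun y => pd_norm_pow_add_const (m + 1) c j y
  have hj : HasFDerivAt (fun y : Vec d => y j)
      (EuclideanSpace.proj j : Vec d →L[ℝ] ℝ) x :=
    (EuclideanSpace.proj j : Vec d →L[ℝ] ℝ).hasFDerivAt
  rw [pdd, h, (((hasFDerivAt_norm_sq_pow m x).fun_mul hj).const_mul _).fderiv]
  simp [EuclideanSpace.inner_single_right, eq_comm]
  split_ifs <;> ring

theorem abs_pd_norm_pow_add_const_le {d : ℕ} (n : ℕ) (c : ℝ) (i : Fin d) (x : Vec d) :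
    |pd (fun y : Vec d => ‖y‖ ^ (2 * (n + 1)) + c) i x|
      ≤ 2 * (n + 1) * ‖x‖ ^ (2 * n + 1) := by
  have hi : |x i| ≤ ‖x‖ := PiLp.norm_apply_le x i
  rw [pd_norm_pow_add_const, abs_mul, abs_mul ((‖x‖ ^ 2) ^ n),
    abs_of_nonneg (by positivity : (0 : ℝ) ≤ 2 * (n + 1)),
    abs_of_nonneg (by positivity : 0 ≤ (‖x‖ ^ 2) ^ n), pow_succ _ (2 * n), pow_mul]
  gcongr

theorem abs_pdd_norm_pow_add_const_le {d : ℕ} (m : ℕ) (c : ℝ) (i j : Fin d) (x : Vec d) :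
    |pdd (fun y : Vec d => ‖y‖ ^ (2 * (m + 2)) + c) i j x|
      ≤ (4 * (m + 2) * (m + 1) + 2 * (m + 2)) * ‖x‖ ^ (2 * m + 2) := by
  have hi : |x i| ≤ ‖x‖ := PiLp.norm_apply_le x i
  have hj : |x j| ≤ ‖x‖ := PiLp.norm_apply_le x j
  rw [pdd_norm_pow_add_const]
  calc _ ≤ |4 * (m + 2) * (m + 1) * (‖x‖ ^ 2) ^ m * (x i * x j)|
        + |2 * (m + 2) * (‖x‖ ^ 2) ^ (m + 1) * (if i = j then 1 else 0)| := abs_add_le _ _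
    _ ≤ 4 * (m + 2) * (m + 1) * (‖x‖ ^ 2) ^ m * (‖x‖ * ‖x‖)
        + 2 * (m + 2) * (‖x‖ ^ 2) ^ (m + 1) * 1 := by
      rw [abs_mul, abs_mul (x i), abs_mul (2 * (m + 2) * (‖x‖ ^ 2) ^ (m + 1)),
        abs_of_nonneg (by positivity : (0 : ℝ) ≤ 4 * (m + 2) * (m + 1) * (‖x‖ ^ 2) ^ m),
        abs_of_nonneg (by positivity : (0 : ℝ) ≤ 2 * (m + 2) * (‖x‖ ^ 2) ^ (m + 1))]
      gcongr
      split_ifs <;> simp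
    _ = _ := by ring

theorem pow_le_one_add_pow {s : ℝ} (hs : 0 ≤ s) {p q : ℕ} (hpq : p ≤ q) :
    s ^ p ≤ s ^ q + 1 := by
  rcases le_total s 1 with h | h
  · linarith [pow_le_one₀ hs h (n := p), pow_nonneg hs q]
  · linarith [pow_le_pow_right₀ h hpq]

/-- Given coefficients `b_i` with linear growth and `a_{ij}` with quadratic
growth, and `r ≥ 0`, `k ≥ 2`, there exist constants `a₀ > 0` and `d' > 0` such that
`Q(x) = |x|^{2k} + d'` satisfies
`Σ_{i,j} a_{ij} ∂²Q/∂x_i∂x_j + Σ_i b_i ∂Q/∂x_i < (r + a₀)·Q(x)` on `[0,T]×ℝ^d`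
(since `Q` does not depend on `t`, this is the action of the full parabolic operator
`ℒ` on `Q`). -/
theorem exists_supersolution_barrier
    (T : ℝ) (hT : 0 < T) (r : ℝ) (hr : 0 ≤ r) (d : ℕ) (k : ℕ) (hk : 2 ≤ k)
    (a : ℝ → Vec d → Fin d → Fin d → ℝ) (b : ℝ → Vec d → Fin d → ℝ)
    (c₁ d₁ c₂ d₂ : ℝ) (hc₁ : 0 < c₁) (hd₁ : 0 < d₁) (hc₂ : 0 < c₂) (hd₂ : 0 < d₂)
    (hb : ∀ t ∈ Set.Icc (0 : ℝ) T, ∀ (x : Vec d) (i : Fin d),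
      |b t x i| < c₁ * ‖x‖ + d₁)
    (ha : ∀ t ∈ Set.Icc (0 : ℝ) T, ∀ (x : Vec d) (i j : Fin d),
      |a t x i j| < c₂ * ‖x‖ ^ 2 + d₂) :
    ∃ a₀ > (0 : ℝ), ∃ d' > (0 : ℝ), ∀ t ∈ Set.Icc (0 : ℝ) T, ∀ x : Vec d,
      (∑ i, ∑ j, a t x i j * pdd (fun y : Vec d => ‖y‖ ^ (2 * k) + d') i j x)
        + ∑ i, b t x i * pd (fun y : Vec d => ‖y‖ ^ (2 * k) + d') i x
      < (r + a₀) * (‖x‖ ^ (2 * k) + d') := by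
  obtain ⟨m, rfl⟩ := Nat.exists_eq_add_of_le' hk
  set A : ℝ := (c₂ + d₂) * (4 * (m + 2) * (m + 1) + 2 * (m + 2)) with hA
  set B : ℝ := (c₁ + d₁) * (2 * (m + 2)) with hB
  refine ⟨d * (d * A) + d * B + 1, by positivity, 1, one_pos, fun t ht x => ?_⟩
  set S : ℝ := ‖x‖ ^ (2 * (m + 2)) + 1 with hS
  have hS0 : 0 < S := by positivity
  have hpow {p : ℕ} (hp : p ≤ 2 * (m + 2)) : ‖x‖ ^ p ≤ S :=
    pow_le_one_add_pow (norm_nonneg x) hp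
  have second_order (i j : Fin d) :
      a t x i j * pdd (fun y : Vec d => ‖y‖ ^ (2 * (m + 2)) + 1) i j x ≤ A * S := by
    calc _ ≤ |a t x i j| * |pdd (fun y : Vec d => ‖y‖ ^ (2 * (m + 2)) + 1) i j x| := by
          rw [← abs_mul]; exact le_abs_self _
      _ ≤ (c₂ * ‖x‖ ^ 2 + d₂)
          * ((4 * (m + 2) * (m + 1) + 2 * (m + 2)) * ‖x‖ ^ (2 * m + 2)) := by
        gcongr
        · exact (ha t ht x i j).le
        · exact abs_pdd_norm_pow_add_const_le m 1 i j x
      _ = (c₂ * ‖x‖ ^ (2 * m + 4) + d₂ * ‖x‖ ^ (2 * m + 2))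
          * (4 * (m + 2) * (m + 1) + 2 * (m + 2)) := by ring
      _ ≤ (c₂ * S + d₂ * S) * (4 * (m + 2) * (m + 1) + 2 * (m + 2)) := by
        gcongr <;> exact hpow (by omega)
      _ = A * S := by rw [hA]; ring
  have first_order (i : Fin d) :
      b t x i * pd (fun y : Vec d => ‖y‖ ^ (2 * (m + 2)) + 1) i x ≤ B * S := by
    have hpd := abs_pd_norm_pow_add_const_le (m + 1) 1 i x
    push_cast at hpd
    calc _ ≤ |b t x i| * |pd (fun y : Vec d => ‖y‖ ^ (2 * (m + 2)) + 1) i x| := by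
          rw [← abs_mul]; exact le_abs_self _
      _ ≤ (c₁ * ‖x‖ + d₁) * (2 * (m + 1 + 1) * ‖x‖ ^ (2 * (m + 1) + 1)) := by
        gcongr
        exact (hb t ht x i).le
      _ = (c₁ * ‖x‖ ^ (2 * m + 4) + d₁ * ‖x‖ ^ (2 * m + 3)) * (2 * (m + 2)) := by ring
      _ ≤ (c₁ * S + d₁ * S) * (2 * (m + 2)) := by
        gcongr <;> exact hpow (by omega)
      _ = B * S := by rw [hB]; ring
  calc _ ≤ (∑ _i : Fin d, ∑ _j : Fin d, A * S) + ∑ _i : Fin d, B * S := by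
        exact add_le_add
          (Finset.sum_le_sum fun i _ => Finset.sum_le_sum fun j _ => second_order i j)
          (Finset.sum_le_sum fun i _ => first_order i)
    _ = (d * (d * A) + d * B) * S := by simp; ring
    _ < (r + (d * (d * A) + d * B + 1)) * S := by
      exact mul_lt_mul_of_pos_right (by linarith) hS0

end
end

section
/- Let T > 0, d ∈ ℕ, λ ≥ 0, κ ≥ 0, and let a_{ij}, b_i : [0,T]×ℝ^d → ℝ be such that for every (t,x) the matrix (a_{ij}(t,x)) is symmetric positive semidefinite. Let l ∈ C^{1,2}([0,T]×ℝ^d) be continuous on [0,T]×ℝ^d and suppose there is M > 0 with l(t,x) < 0 whenever |x| > M, and l(T,x) ≤ 0 for all x. Let G : [0,T]×ℝ^d → ℝ and suppose that λ·l(t,x)^+ ≤ ℒl(t,x) − κ·l(t,x) + G(t,x) for all (t,x) ∈ [0,T)×ℝ^d. Then for every (t,x) ∈ [0,T]×ℝ^d, λ·l(t,x)^+ ≤ max(0, sup_{(s,y)∈[0,T)×ℝ^d} G(s,y)). -/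
open scoped BigOperators

noncomputable section

/-- The time derivative `∂u/∂t` of `u : [0,T]×ℝ^d → ℝ`. -/
noncomputable def tderiv {d : ℕ} (u : ℝ → Vec d → ℝ) (t : ℝ) (x : Vec d) : ℝ :=
  deriv (fun s => u s x) t

/-- The spatial partial derivative `∂u/∂x_i`. -/
noncomputable def pderiv1 {d : ℕ} (u : ℝ → Vec d → ℝ) (i : Fin d) (t : ℝ) (x : Vec d) : ℝ :=
  fderiv ℝ (u t) x (EuclideanSpace.single i 1)

/-- The spatial second partial derivative `∂²u/∂x_i∂x_j`. -/
noncomputable def pderiv2 {d : ℕ} (u : ℝ → Vec d → ℝ) (i j : Fin d) (t : ℝ) (x : Vec d) : ℝ :=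
  fderiv ℝ (fun y => fderiv ℝ (u t) y (EuclideanSpace.single j 1)) x (EuclideanSpace.single i 1)

/-- The parabolic operator
`ℒu = ∂_t u + Σ_{i,j} a_{ij} ∂²u/∂x_i∂x_j + Σ_i b_i ∂u/∂x_i`. -/
noncomputable def Lop {d : ℕ} (a : ℝ → Vec d → Fin d → Fin d → ℝ)
    (b : ℝ → Vec d → Fin d → ℝ) (u : ℝ → Vec d → ℝ) (t : ℝ) (x : Vec d) : ℝ :=
  tderiv u t x + (∑ i, ∑ j, a t x i j * pderiv2 u i j t x)
    + ∑ i, b t x i * pderiv1 u i t x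

/-- `u ∈ C^{1,2}([0,T]×ℝ^d)`: `u` is continuous on `[0,T]×ℝ^d`, once differentiable in
time and twice continuously differentiable in space there, with all these derivatives
continuous on `[0,T]×ℝ^d`. -/
def C12 {d : ℕ} (T : ℝ) (u : ℝ → Vec d → ℝ) : Prop :=
  ContinuousOn (fun q : ℝ × Vec d => u q.1 q.2) (Set.Icc 0 T ×ˢ Set.univ) ∧
  (∀ x : Vec d, ∀ t ∈ Set.Icc (0 : ℝ) T, DifferentiableAt ℝ (fun s => u s x) t) ∧
  (∀ t ∈ Set.Icc (0 : ℝ) T, ContDiff ℝ 2 (u t)) ∧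
  ContinuousOn (fun q : ℝ × Vec d => tderiv u q.1 q.2) (Set.Icc 0 T ×ˢ Set.univ) ∧
  (∀ i, ContinuousOn (fun q : ℝ × Vec d => pderiv1 u i q.1 q.2) (Set.Icc 0 T ×ˢ Set.univ)) ∧
  (∀ i j, ContinuousOn (fun q : ℝ × Vec d => pderiv2 u i j q.1 q.2) (Set.Icc 0 T ×ˢ Set.univ))

/-- `φ : [0,T]×ℝ^d → E` is uniformly 1/2-Hölder continuous in `t` and uniformly
Lipschitz continuous in `x`. -/
def HolLip {d : ℕ} {E : Type*} [NormedAddCommGroup E] (T : ℝ) (φ : ℝ → Vec d → E) : Prop :=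
  ∃ L > (0 : ℝ), ∀ t ∈ Set.Icc (0 : ℝ) T, ∀ s ∈ Set.Icc (0 : ℝ) T, ∀ x y : Vec d,
    ‖φ t x - φ s y‖ ≤ L * (|t - s| ^ ((1 : ℝ) / 2) + ‖x - y‖)

/-- `u` has quadratic growth on `[0,T]×ℝ^d`: `|u(t,x)| ≤ K(1 + |x|²)`. -/
def QuadGrowth {d : ℕ} (T : ℝ) (u : ℝ → Vec d → ℝ) : Prop :=
  ∃ K > (0 : ℝ), ∀ t ∈ Set.Icc (0 : ℝ) T, ∀ x : Vec d, |u t x| ≤ K * (1 + ‖x‖ ^ 2)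

/-- The second derivative is nonpositive at a local maximum. -/
theorem IsLocalMax.deriv_deriv_nonpos {f : ℝ → ℝ} {x : ℝ} (h : IsLocalMax f x)
    (hc : ContinuousAt f x) : deriv (deriv f) x ≤ 0 := by
  by_contra! hpos
  have hmin := isLocalMin_of_deriv_deriv_pos hpos h.deriv_eq_zero hc
  have hconst : f =ᶠ[nhds x] fun _ => f x := by
    filter_upwards [h, hmin] with y hy hy' using le_antisymm hy hy'
  have := hconst.deriv.deriv_eq
  simp at this
  linarith

/-- The second Fréchet derivative is negative semidefinite at a local maximum. -/
theorem IsLocalMax.fderiv_fderiv_nonpos {E : Type*} [NormedAddCommGroup E] [NormedSpace ℝ E]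
    {g : E → ℝ} {x : E} (h : IsLocalMax g x) (hg : ContDiff ℝ 2 g) (v : E) :
    fderiv ℝ (fderiv ℝ g) x v v ≤ 0 := by
  have hline : ∀ s : ℝ, HasDerivAt (fun s : ℝ => x + s • v) v s := fun s => by
    simpa using ((hasDerivAt_id s).smul_const v).const_add x
  have hderiv : deriv (fun s : ℝ => g (x + s • v)) = fun s => fderiv ℝ g (x + s • v) v := by
    funext s
    exact ((hg.differentiable (by norm_num) _).hasFDerivAt.comp_hasDerivAt s (hline s)).deriv
  have hdiff : Differentiable ℝ (fderiv ℝ g) :=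
    (hg.fderiv_right (m := 1) (by norm_num)).differentiable (by norm_num)
  have hderiv2 : deriv (deriv (fun s : ℝ => g (x + s • v))) 0 = fderiv ℝ (fderiv ℝ g) x v v := by
    rw [hderiv]
    have hat : HasFDerivAt (fun y => fderiv ℝ g y v)
        ((fderiv ℝ (fderiv ℝ g) x).flip v) (x + (0 : ℝ) • v) := by
      simpa using (hdiff x).hasFDerivAt.clm_apply (hasFDerivAt_const v x)
    exact (hat.comp_hasDerivAt (0 : ℝ) (hline 0)).deriv
  have hcont : ContinuousAt (fun s : ℝ => x + s • v) 0 := (hline 0).continuousAt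
  have hmax : IsLocalMax (fun s : ℝ => g (x + s • v)) 0 := by
    have ht : Filter.Tendsto (fun s : ℝ => x + s • v) (nhds 0) (nhds x) := by
      simpa [ContinuousAt] using hcont
    simpa [IsLocalMax, IsMaxFilter] using ht.eventually h
  rw [← hderiv2]
  exact hmax.deriv_deriv_nonpos (hg.continuous.continuousAt.comp hcont)

/-- The derivative is nonpositive where a function is maximal over an interval to the right. -/
theorem IsMaxOn.deriv_nonpos_left_endpoint {f : ℝ → ℝ} {s T : ℝ} (hsT : s < T)
    (h : IsMaxOn f (Set.Icc s T) s) (hf : DifferentiableAt ℝ f s) : deriv f s ≤ 0 := by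
  have hdir := sub_mem_posTangentConeAt_of_segment_subset (segment_eq_Icc hsT.le).subset
  have := h.localize.hasFDerivWithinAt_nonpos hf.hasFDerivAt.hasFDerivWithinAt hdir
  rw [← toSpanSingleton_deriv] at this
  simp only [ContinuousLinearMap.toSpanSingleton_apply, smul_eq_mul] at this
  exact nonpos_of_mul_nonpos_right this (sub_pos.2 hsT)

/-- The contraction of a positive semidefinite matrix with a bilinear form that is negative
semidefinite is nonpositive. -/
theorem Matrix.PosSemidef.sum_mul_nonpos {ι E : Type*} [Fintype ι] [AddCommGroup E] [Module ℝ E]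
    {A : Matrix ι ι ℝ} (hA : A.PosSemidef) (e : ι → E) (Q : E →ₗ[ℝ] E →ₗ[ℝ] ℝ)
    (hQ : ∀ v, Q v v ≤ 0) : ∑ i, ∑ j, A i j * Q (e i) (e j) ≤ 0 := by
  obtain ⟨m, c, rfl⟩ := Matrix.posSemidef_iff_eq_sum_vecMulVec.1 hA
  calc ∑ i, ∑ j, (∑ k, Matrix.vecMulVec (c k) (star (c k))) i j * Q (e i) (e j)
      = ∑ k, Q (∑ i, c k i • e i) (∑ j, c k j • e j) := by
        simp only [Matrix.sum_apply, Matrix.vecMulVec_apply, Finset.sum_mul, map_sum, map_smul,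
          LinearMap.sum_apply, LinearMap.smul_apply, smul_eq_mul, star_trivial,
          Finset.mul_sum]
        rw [Finset.sum_congr rfl fun i _ => Finset.sum_comm, Finset.sum_comm]
        refine Finset.sum_congr rfl fun k _ => ?_
        rw [Finset.sum_comm]
        refine Finset.sum_congr rfl fun i _ => Finset.sum_congr rfl fun j _ => ?_
        ring
    _ ≤ 0 := Finset.sum_nonpos fun k _ => hQ _

theorem pderiv2_eq_fderiv_fderiv {d : ℕ} {u : ℝ → Vec d → ℝ} {t : ℝ} (hu : ContDiff ℝ 2 (u t))
    (i j : Fin d) (x : Vec d) :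
    pderiv2 u i j t x =
      fderiv ℝ (fderiv ℝ (u t)) x (EuclideanSpace.single i 1) (EuclideanSpace.single j 1) := by
  have hdiff : Differentiable ℝ (fderiv ℝ (u t)) :=
    (hu.fderiv_right (m := 1) (by norm_num)).differentiable (by norm_num)
  rw [pderiv2, fderiv_clm_apply (hdiff x) (differentiableAt_const _)]
  simp

/-- The parabolic operator is nonpositive at a maximum over `[0,T]×ℝ^d` with `t < T`. -/
theorem Lop_nonpos_of_isMax {d : ℕ} {T : ℝ} {u : ℝ → Vec d → ℝ} (hu : C12 T u)
    {a : ℝ → Vec d → Fin d → Fin d → ℝ} {b : ℝ → Vec d → Fin d → ℝ} {t : ℝ} {x : Vec d}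
    (ha : (Matrix.of (a t x)).PosSemidef) (ht : t ∈ Set.Ico 0 T)
    (hmax : ∀ s ∈ Set.Icc 0 T, ∀ y, u s y ≤ u t x) : Lop a b u t x ≤ 0 := by
  obtain ⟨-, htime, hspace, -⟩ := hu
  have htI : t ∈ Set.Icc 0 T := Set.Ico_subset_Icc_self ht
  have htderiv : tderiv u t x ≤ 0 :=
    IsMaxOn.deriv_nonpos_left_endpoint ht.2
      (fun s hs => hmax s ⟨ht.1.trans hs.1, hs.2⟩ x) (htime x t htI)
  have hloc : IsLocalMax (u t) x := Filter.Eventually.of_forall fun y => hmax t htI y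
  have hgrad : ∑ i, b t x i * pderiv1 u i t x = 0 :=
    Finset.sum_eq_zero fun i _ => by simp [pderiv1, hloc.fderiv_eq_zero]
  have hhess : ∑ i, ∑ j, a t x i j * pderiv2 u i j t x ≤ 0 := by
    simp only [pderiv2_eq_fderiv_fderiv (hspace t htI)]
    exact ha.sum_mul_nonpos (fun i => EuclideanSpace.single i 1)
      (ContinuousLinearMap.coeLM ℝ ∘ₗ (fderiv ℝ (fderiv ℝ (u t)) x).toLinearMap)
      (hloc.fderiv_fderiv_nonpos (hspace t htI))
  rw [Lop, hgrad]
  linarith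

/-- A function that is negative for `|x| > M` and positive somewhere on `[0,T]×ℝ^d` attains its
maximum there. -/
theorem exists_isMax_of_neg_outside_ball {d : ℕ} {T M : ℝ} {u : ℝ → Vec d → ℝ}
    (hu : ContinuousOn (fun q : ℝ × Vec d => u q.1 q.2) (Set.Icc 0 T ×ˢ Set.univ))
    (hneg : ∀ t ∈ Set.Icc 0 T, ∀ x, M < ‖x‖ → u t x < 0)
    {t : ℝ} (ht : t ∈ Set.Icc 0 T) {x : Vec d} (hpos : 0 < u t x) :
    ∃ t₀ ∈ Set.Icc 0 T, ∃ x₀, ∀ s ∈ Set.Icc 0 T, ∀ y, u s y ≤ u t₀ x₀ := by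
  have hmem : ∀ y, ¬ M < ‖y‖ → y ∈ Metric.closedBall (0 : Vec d) M := fun y hy => by
    simpa using hy
  have hx := hmem x fun h => (hneg t ht x h).not_gt hpos
  obtain ⟨⟨t₀, x₀⟩, ⟨ht₀, -⟩, hmax⟩ :=
    (isCompact_Icc.prod (isCompact_closedBall (0 : Vec d) M)).exists_isMaxOn ⟨(t, x), ht, hx⟩
      (hu.mono (Set.prod_mono_right (Set.subset_univ _)))
  have hle : ∀ s ∈ Set.Icc 0 T, ∀ y ∈ Metric.closedBall (0 : Vec d) M, u s y ≤ u t₀ x₀ :=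
    fun s hs y hy => hmax (Set.mk_mem_prod hs hy)
  refine ⟨t₀, ht₀, x₀, fun s hs y => ?_⟩
  by_cases hy : M < ‖y‖
  · exact ((hneg s hs y hy).trans (hpos.trans_le (hle t ht x hx))).le
  · exact hle s hs y (hmem y hy)

/-- parabolic maximum-principle step used to bound the penalty term:
Let `(a_{ij}(t,x))` be symmetric positive semidefinite, `λ, κ ≥ 0`, let
`l ∈ C^{1,2}([0,T]×ℝ^d)` with `l(t,x) < 0` for `|x| > M` and `l(T,·) ≤ 0`, and
suppose `λ·l⁺ ≤ ℒl − κ·l + G` on `[0,T)×ℝ^d`.  Then for every `(t,x) ∈ [0,T]×ℝ^d`,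
`λ·l(t,x)⁺ ≤ max(0, sup_{[0,T)×ℝ^d} G)` (the supremum taken in the extended reals). -/
theorem penalty_bound_via_maximum_principle
    (T : ℝ) (hT : 0 < T) (d : ℕ) (lam κ : ℝ) (hlam : 0 ≤ lam) (hκ : 0 ≤ κ)
    (A : ℝ → Vec d → Fin d → Fin d → ℝ) (B : ℝ → Vec d → Fin d → ℝ)
    (hAsymm : ∀ t x i j, A t x i j = A t x j i)
    (hApsd : ∀ (t : ℝ) (x : Vec d) (ξ : Fin d → ℝ),
      0 ≤ ∑ i, ∑ j, A t x i j * ξ i * ξ j)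
    (l : ℝ → Vec d → ℝ) (hlC12 : C12 T l)
    (M : ℝ) (hM : 0 < M)
    (hlneg : ∀ t ∈ Set.Icc (0 : ℝ) T, ∀ x : Vec d, M < ‖x‖ → l t x < 0)
    (hlT : ∀ x : Vec d, l T x ≤ 0)
    (G : ℝ → Vec d → ℝ)
    (hineq : ∀ t ∈ Set.Ico (0 : ℝ) T, ∀ x : Vec d,
      lam * max (l t x) 0 ≤ Lop A B l t x - κ * l t x + G t x) :
    ∀ t ∈ Set.Icc (0 : ℝ) T, ∀ x : Vec d,
      ((lam * max (l t x) 0 : ℝ) : EReal) ≤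
        max 0 (⨆ s ∈ Set.Ico (0 : ℝ) T, ⨆ z : Vec d, ((G s z : ℝ) : EReal)) := by
  intro t ht x
  rcases le_or_gt (l t x) 0 with hx | hpos
  · simp [max_eq_right hx]
  obtain ⟨t₀, ht₀, x₀, hmax⟩ := exists_isMax_of_neg_outside_ball hlC12.1 hlneg ht hpos
  have hpos₀ : 0 < l t₀ x₀ := hpos.trans_le (hmax t ht x)
  have ht₀T : t₀ ∈ Set.Ico 0 T :=
    ⟨ht₀.1, lt_of_le_of_ne ht₀.2 fun h => (hlT x₀).not_gt (h ▸ hpos₀)⟩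
  have hpsd : (Matrix.of (A t₀ x₀)).PosSemidef := by
    refine Matrix.PosSemidef.of_dotProduct_mulVec_nonneg
      (Matrix.IsHermitian.ext fun i j => hAsymm t₀ x₀ j i) fun ξ => ?_
    refine (hApsd t₀ x₀ ξ).trans_eq ?_
    simp only [dotProduct, Matrix.mulVec, Finset.mul_sum, Matrix.of_apply, Pi.star_apply,
      star_trivial]
    refine Finset.sum_congr rfl fun i _ => Finset.sum_congr rfl fun j _ => ?_
    ring
  have hL : Lop A B l t₀ x₀ ≤ 0 := Lop_nonpos_of_isMax hlC12 hpsd ht₀T hmax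
  have hbound : lam * max (l t x) 0 ≤ G t₀ x₀ :=
    calc lam * max (l t x) 0 ≤ lam * max (l t₀ x₀) 0 := by
          gcongr
          exact hmax t ht x
      _ ≤ Lop A B l t₀ x₀ - κ * l t₀ x₀ + G t₀ x₀ := hineq t₀ ht₀T x₀
      _ ≤ G t₀ x₀ := by linarith [mul_nonneg hκ hpos₀.le]
  calc ((lam * max (l t x) 0 : ℝ) : EReal) ≤ (G t₀ x₀ : EReal) := EReal.coe_le_coe_iff.2 hbound
    _ ≤ ⨆ s ∈ Set.Ico (0 : ℝ) T, ⨆ z : Vec d, ((G s z : ℝ) : EReal) :=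
        (le_iSup (fun z => (G t₀ z : EReal)) x₀).trans
          (le_iSup₂ (f := fun s (_ : s ∈ Set.Ico (0 : ℝ) T) => ⨆ z : Vec d, (G s z : EReal))
            t₀ ht₀T)
    _ ≤ _ := le_max_right _ _

end
end

section
/- Let T > 0, d ∈ ℕ, and let a_{ij}, b_i : [0,T]×ℝ^d → ℝ satisfy: (a_{ij}(t,x)) is symmetric positive semidefinite for every (t,x), |a_{ij}(t,x)| ≤ c₂|x|² + d₂ and |b_i(t,x)| ≤ c₁|x| + d₁ for positive constants c₁, d₁, c₂, d₂. Let γ : [0,T]×ℝ^d → ℝ satisfy γ(t,x) ≥ 0 everywhere. Let u ∈ C^{1,2}([0,T]×ℝ^d) be continuous with polynomial growth, i.e. |u(t,x)| ≤ K(1 + |x|^q) for some K > 0 and q ≥ 0, and suppose ℒu(t,x) − γ(t,x)·u(t,x) ≤ 0 for all (t,x) ∈ [0,T)×ℝ^d and u(T,x) ≥ 0 for all x ∈ ℝ^d. Then u(t,x) ≥ 0 for all (t,x) ∈ [0,T]×ℝ^d. -/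
open scoped BigOperators

noncomputable section

theorem sum_mul_nonneg_of_posSemidef {ι : Type*} [Fintype ι] (A H : ι → ι → ℝ)
    (hAsymm : ∀ i j, A i j = A j i)
    (hA : ∀ ξ : ι → ℝ, 0 ≤ ∑ i, ∑ j, A i j * ξ i * ξ j)
    (hH : ∀ ξ : ι → ℝ, 0 ≤ ∑ i, ∑ j, ξ i * ξ j * H i j) :
    0 ≤ ∑ i, ∑ j, A i j * H i j := by
  have hpsd : (Matrix.of A).PosSemidef := by
    refine Matrix.PosSemidef.of_dotProduct_mulVec_nonneg ?_ fun ξ => ?_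
    · ext i j
      simp [hAsymm j i]
    · refine (hA ξ).trans_eq ?_
      simp only [dotProduct, Matrix.mulVec, Matrix.of_apply, Finset.mul_sum, Pi.star_apply,
        star_trivial]
      exact Finset.sum_congr rfl fun i _ => Finset.sum_congr rfl fun j _ => by ring
  obtain ⟨m, v, hv⟩ := Matrix.posSemidef_iff_eq_sum_vecMulVec.mp hpsd
  have hentry : ∀ i j, A i j = ∑ k, v k i * v k j := fun i j => by
    have := congrFun (congrFun hv i) j
    simpa [Matrix.sum_apply, Matrix.vecMulVec_apply] using this
  calc 0 ≤ ∑ k, ∑ i, ∑ j, v k i * v k j * H i j := Finset.sum_nonneg fun k _ => hH (v k)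
    _ = ∑ i, ∑ j, A i j * H i j := by
      rw [Finset.sum_comm]
      refine Finset.sum_congr rfl fun i _ => ?_
      rw [Finset.sum_comm]
      refine Finset.sum_congr rfl fun j _ => ?_
      rw [hentry, Finset.sum_mul]

theorem IsLocalMin.deriv_deriv_nonneg {f : ℝ → ℝ} {x : ℝ} (h : IsLocalMin f x)
    (hf : ContinuousAt f x) : 0 ≤ deriv (deriv f) x := by
  by_contra! hneg
  have hmax := isLocalMax_of_deriv_deriv_neg hneg h.deriv_eq_zero hf
  have hconst : f =ᶠ[nhds x] fun _ => f x := by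
    filter_upwards [h, hmax] with y h₁ h₂ using le_antisymm h₂ h₁
  have := hconst.deriv.deriv_eq
  simp at this
  linarith

theorem EuclideanSpace.clm_apply_eq_sum {d : ℕ} (L : Vec d →L[ℝ] ℝ) (ξ : Vec d) :
    L ξ = ∑ i, ξ i * L (EuclideanSpace.single i 1) := by
  conv_lhs => rw [← (EuclideanSpace.basisFun (Fin d) ℝ).sum_repr ξ]
  simp

theorem ContDiff.differentiable_fderiv_apply {d : ℕ} {f : Vec d → ℝ} (hf : ContDiff ℝ 2 f)
    (v : Vec d) : Differentiable ℝ fun y => fderiv ℝ f y v :=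
  ((hf.fderiv_right (m := 1) (by norm_num)).differentiable (by norm_num)).clm_apply
    (differentiable_const v)

theorem IsLocalMin.hessian_nonneg {d : ℕ} {f : Vec d → ℝ} {x : Vec d} (h : IsLocalMin f x)
    (hf : ContDiff ℝ 2 f) (ξ : Fin d → ℝ) :
    0 ≤ ∑ i, ∑ j, ξ i * ξ j * fderiv ℝ (fun y => fderiv ℝ f y (EuclideanSpace.single j 1)) x
      (EuclideanSpace.single i 1) := by
  set v : Vec d := WithLp.toLp 2 ξ
  have hline : ∀ s : ℝ, HasDerivAt (fun s : ℝ => x + s • v) v s := fun s => by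
    simpa using ((hasDerivAt_id s).smul_const v).const_add x
  have hfd : Differentiable ℝ f := hf.differentiable (by norm_num)
  have hd₁ : deriv (fun s : ℝ => f (x + s • v)) = fun s =>
      ∑ j, ξ j * fderiv ℝ f (x + s • v) (EuclideanSpace.single j 1) := by
    funext s
    exact ((hfd _).hasFDerivAt.comp_hasDerivAt s (hline s)).deriv.trans
      (EuclideanSpace.clm_apply_eq_sum _ _)
  have hd₂ : deriv (deriv fun s : ℝ => f (x + s • v)) 0 = ∑ j, ξ j *
      fderiv ℝ (fun y => fderiv ℝ f y (EuclideanSpace.single j 1)) x v := by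
    rw [hd₁]
    refine HasDerivAt.deriv (HasDerivAt.fun_sum fun j _ => HasDerivAt.const_mul _ ?_)
    have := ((hf.differentiable_fderiv_apply (EuclideanSpace.single j 1))
      (x + (0 : ℝ) • v)).hasFDerivAt.comp_hasDerivAt 0 (hline 0)
    simpa [Function.comp_def] using this
  have hcont : Continuous fun s : ℝ => x + s • v := by fun_prop
  have hmin : IsLocalMin (fun s : ℝ => f (x + s • v)) 0 := by
    have h' : IsLocalMin f (x + (0 : ℝ) • v) := by simpa using h
    exact h'.comp_continuous (f := f) (g := fun s : ℝ => x + s • v) hcont.continuousAt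
  have hnn := hmin.deriv_deriv_nonneg (hfd.continuous.comp hcont).continuousAt
  rw [hd₂] at hnn
  refine hnn.trans_eq ?_
  rw [Finset.sum_comm]
  refine Finset.sum_congr rfl fun j _ => ?_
  rw [EuclideanSpace.clm_apply_eq_sum _ v, Finset.mul_sum]
  exact Finset.sum_congr rfl fun i _ => by ring

theorem deriv_nonneg_of_isMinOn_Icc {f : ℝ → ℝ} {t T : ℝ} (htT : t < T)
    (hmin : IsMinOn f (Set.Icc t T) t) (hf : DifferentiableAt ℝ f t) : 0 ≤ deriv f t := by
  have hcone : T - t ∈ posTangentConeAt (Set.Icc t T) t :=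
    sub_mem_posTangentConeAt_of_segment_subset (by rw [segment_eq_Icc htT.le])
  have := hmin.localize.hasFDerivWithinAt_nonneg
    hf.hasDerivAt.hasFDerivAt.hasFDerivWithinAt hcone
  simp only [ContinuousLinearMap.toSpanSingleton_apply, smul_eq_mul] at this
  exact nonneg_of_mul_nonneg_right this (sub_pos.2 htT)

/-- At a spatial minimum where the time derivative is nonnegative, `ℒg` is nonnegative. -/
theorem Lop_nonneg_of_isLocalMin {d : ℕ} {A : ℝ → Vec d → Fin d → Fin d → ℝ}
    {B : ℝ → Vec d → Fin d → ℝ} {g : ℝ → Vec d → ℝ} {t : ℝ} {x : Vec d}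
    (hAsymm : ∀ i j, A t x i j = A t x j i)
    (hApsd : ∀ ξ : Fin d → ℝ, 0 ≤ ∑ i, ∑ j, A t x i j * ξ i * ξ j)
    (hg : ContDiff ℝ 2 (g t)) (hmin : IsLocalMin (g t) x) (ht : 0 ≤ tderiv g t x) :
    0 ≤ Lop A B g t x := by
  have h₁ : ∀ i, pderiv1 g i t x = 0 := fun i => by simp [pderiv1, hmin.fderiv_eq_zero]
  have h₂ : 0 ≤ ∑ i, ∑ j, A t x i j * pderiv2 g i j t x :=
    sum_mul_nonneg_of_posSemidef _ _ hAsymm hApsd (hmin.hessian_nonneg hg)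
  simp only [Lop, h₁, mul_zero, Finset.sum_const_zero, add_zero]
  exact add_nonneg ht h₂

theorem Lop_add {d : ℕ} (A : ℝ → Vec d → Fin d → Fin d → ℝ)
    (B : ℝ → Vec d → Fin d → ℝ) {u h : ℝ → Vec d → ℝ} {t : ℝ} {x : Vec d}
    (hut : DifferentiableAt ℝ (fun s => u s x) t) (hht : DifferentiableAt ℝ (fun s => h s x) t)
    (hu : ContDiff ℝ 2 (u t)) (hh : ContDiff ℝ 2 (h t)) :
    Lop A B (fun s y => u s y + h s y) t x = Lop A B u t x + Lop A B h t x := by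
  have hfd : ∀ (y v : Vec d), fderiv ℝ (fun y => u t y + h t y) y v =
      fderiv ℝ (u t) y v + fderiv ℝ (h t) y v := fun y v => by
    rw [fderiv_fun_add (hu.differentiable (by norm_num) y) (hh.differentiable (by norm_num) y)]
    rfl
  have h₂ : ∀ i j, pderiv2 (fun s y => u s y + h s y) i j t x =
      pderiv2 u i j t x + pderiv2 h i j t x := fun i j => by
    simp only [pderiv2, hfd]
    rw [fderiv_fun_add (hu.differentiable_fderiv_apply _ x) (hh.differentiable_fderiv_apply _ x)]
    rfl
  have h₁ : ∀ i, pderiv1 (fun s y => u s y + h s y) i t x =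
      pderiv1 u i t x + pderiv1 h i t x := fun i => hfd x _
  have h₀ : tderiv (fun s y => u s y + h s y) t x = tderiv u t x + tderiv h t x :=
    deriv_fun_add hut hht
  simp only [Lop, h₀, h₁, h₂, mul_add, Finset.sum_add_distrib]
  ring

/-- A supersolution of polynomial growth of order `2 (n + 2)`, for large `l`. -/
def barrier {d : ℕ} (ε l T : ℝ) (n : ℕ) (t : ℝ) (x : Vec d) : ℝ :=
  ε * Real.exp (l * (T - t)) * (1 + ‖x‖ ^ 2) ^ (n + 2)

section barrier

variable {d : ℕ} (ε l T : ℝ) (n : ℕ) (t : ℝ) (x : Vec d)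

theorem barrier_contDiff : ContDiff ℝ 2 (barrier (d := d) ε l T n t) := by
  unfold barrier
  exact contDiff_const.mul ((contDiff_const.add (contDiff_norm_sq ℝ)).pow _)

theorem barrier_continuous :
    Continuous fun p : ℝ × Vec d => barrier ε l T n p.1 p.2 := by
  unfold barrier
  fun_prop

theorem barrier_hasDerivAt :
    HasDerivAt (fun s => barrier ε l T n s x) (-l * barrier ε l T n t x) t := by
  have := (((((hasDerivAt_id t).const_sub T).const_mul l).exp).const_mul ε).mul_const
    ((1 + ‖x‖ ^ 2) ^ (n + 2))
  refine this.congr_deriv ?_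
  simp only [barrier, id]
  ring

theorem hasFDerivAt_one_add_norm_sq_pow (m : ℕ) :
    HasFDerivAt (fun y : Vec d => (1 + ‖y‖ ^ 2) ^ (m + 1))
      ((2 * (m + 1) * (1 + ‖x‖ ^ 2) ^ m) • innerSL ℝ x) x := by
  have := (((hasStrictFDerivAt_norm_sq x).hasFDerivAt).const_add 1).pow (m + 1)
  refine this.congr_fderiv ?_
  ext v
  simp
  ring

theorem pderiv1_barrier (i : Fin d) : pderiv1 (barrier ε l T n) i t x =
    ε * Real.exp (l * (T - t)) * (2 * (n + 2) * (1 + ‖x‖ ^ 2) ^ (n + 1) * x i) := by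
  have := (hasFDerivAt_one_add_norm_sq_pow x (n + 1)).const_mul (ε * Real.exp (l * (T - t)))
  unfold pderiv1 barrier
  rw [this.fderiv]
  simp [EuclideanSpace.inner_single_right, -mul_eq_mul_left_iff, -mul_eq_mul_right_iff]
  ring

theorem pderiv2_barrier (i j : Fin d) : pderiv2 (barrier ε l T n) i j t x =
    ε * Real.exp (l * (T - t)) * (2 * (n + 2)) *
      (2 * (n + 1) * (1 + ‖x‖ ^ 2) ^ n * x i * x j +
        (1 + ‖x‖ ^ 2) ^ (n + 1) * if i = j then 1 else 0) := by
  have hcoord : HasFDerivAt (fun y : Vec d => y j) (EuclideanSpace.proj (𝕜 := ℝ) j) x :=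
    (EuclideanSpace.proj (𝕜 := ℝ) j : Vec d →L[ℝ] ℝ).hasFDerivAt
  have := ((hasFDerivAt_one_add_norm_sq_pow x n).fun_mul hcoord).const_mul
    (ε * Real.exp (l * (T - t)) * (2 * (n + 2)))
  have heq : (fun y : Vec d => fderiv ℝ (barrier ε l T n t) y (EuclideanSpace.single j 1)) =
      fun y => ε * Real.exp (l * (T - t)) * (2 * (n + 2)) * ((1 + ‖y‖ ^ 2) ^ (n + 1) * y j) := by
    funext y
    exact (pderiv1_barrier ε l T n t y j).trans (by ring)
  unfold pderiv2
  rw [heq, HasFDerivAt.fderiv this]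
  simp [EuclideanSpace.inner_single_right, eq_comm,
    -mul_eq_mul_left_iff, -mul_eq_mul_right_iff]
  split_ifs <;> ring

end barrier

theorem abs_coord_mul_le {d : ℕ} (x : Vec d) (i j : Fin d) : |x i * x j| ≤ 1 + ‖x‖ ^ 2 := by
  have h : ∀ i, |x i| ≤ ‖x‖ := fun i => PiLp.norm_apply_le x i
  rw [abs_mul]
  nlinarith [mul_le_mul (h i) (h j) (abs_nonneg _) (norm_nonneg x)]

theorem Lop_barrier_neg {d : ℕ} {A : ℝ → Vec d → Fin d → Fin d → ℝ}
    {B : ℝ → Vec d → Fin d → ℝ} {c₁ d₁ c₂ d₂ : ℝ} (hc₁ : 0 ≤ c₁) (hd₁ : 0 ≤ d₁)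
    (hc₂ : 0 ≤ c₂) (hd₂ : 0 ≤ d₂) {t : ℝ} {x : Vec d}
    (hA : ∀ i j, |A t x i j| ≤ c₂ * ‖x‖ ^ 2 + d₂) (hB : ∀ i, |B t x i| ≤ c₁ * ‖x‖ + d₁)
    {ε l : ℝ} (T : ℝ) (n : ℕ) (hε : 0 < ε)
    (hl : d * (d * ((c₂ + d₂) * (2 * (n + 2) * (2 * (n + 1) + 1)))) +
      d * ((c₁ + d₁) * (2 * (n + 2))) < l) :
    Lop A B (barrier ε l T n) t x < 0 := by
  set r := 1 + ‖x‖ ^ 2 with hr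
  set E := ε * Real.exp (l * (T - t)) with hE
  have hE0 : 0 < E := by positivity
  have hr0 : 0 < r := by positivity
  have hx0 := norm_nonneg x
  have h₂ : ∀ i j, A t x i j * pderiv2 (barrier ε l T n) i j t x ≤
      (c₂ + d₂) * (2 * (n + 2) * (2 * (n + 1) + 1)) * (E * r ^ (n + 2)) := fun i j => by
    have hAr : |A t x i j| ≤ (c₂ + d₂) * r := (hA i j).trans (by rw [hr]; nlinarith)
    have hw : |pderiv2 (barrier ε l T n) i j t x| ≤
        E * (2 * (n + 2)) * ((2 * (n + 1) + 1) * r ^ (n + 1)) := by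
      rw [pderiv2_barrier, abs_mul, abs_of_pos (by positivity : 0 < E * (2 * ((n : ℝ) + 2)))]
      refine mul_le_mul_of_nonneg_left ?_ (by positivity)
      refine (abs_add_le _ _).trans ?_
      have e₁ : |2 * ((n : ℝ) + 1) * r ^ n * x i * x j| ≤ 2 * (n + 1) * r ^ (n + 1) := by
        rw [mul_assoc, abs_mul, abs_of_pos (by positivity : 0 < 2 * ((n : ℝ) + 1) * r ^ n),
          pow_succ, ← mul_assoc]
        exact mul_le_mul_of_nonneg_left (abs_coord_mul_le x i j) (by positivity)
      have e₂ : |r ^ (n + 1) * if i = j then (1 : ℝ) else 0| ≤ r ^ (n + 1) := by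
        split_ifs
        · simp [abs_of_pos hr0]
        · simpa using (pow_pos hr0 (n + 1)).le
      linarith
    calc _ ≤ |A t x i j| * |pderiv2 (barrier ε l T n) i j t x| := by
            rw [← abs_mul]; exact le_abs_self _
      _ ≤ (c₂ + d₂) * r * (E * (2 * (n + 2)) * ((2 * (n + 1) + 1) * r ^ (n + 1))) :=
            mul_le_mul hAr hw (abs_nonneg _) (by positivity)
      _ = _ := by ring
  have h₁ : ∀ i, B t x i * pderiv1 (barrier ε l T n) i t x ≤
      (c₁ + d₁) * (2 * (n + 2)) * (E * r ^ (n + 2)) := fun i => by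
    have hBx : |B t x i| * |x i| ≤ (c₁ + d₁) * r := by
      refine (mul_le_mul (hB i) (PiLp.norm_apply_le x i) (norm_nonneg _) (by positivity)).trans ?_
      have h1 : ‖x‖ ≤ r := by rw [hr]; nlinarith [sq_nonneg (‖x‖ - 1)]
      have h2 : ‖x‖ ^ 2 ≤ r := by rw [hr]; linarith
      nlinarith [mul_le_mul_of_nonneg_left h1 hd₁, mul_le_mul_of_nonneg_left h2 hc₁]
    rw [pderiv1_barrier]
    calc _ = E * (2 * (n + 2) * r ^ (n + 1)) * (B t x i * x i) := by ring
      _ ≤ E * (2 * (n + 2) * r ^ (n + 1)) * ((c₁ + d₁) * r) := by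
            refine mul_le_mul_of_nonneg_left ((le_abs_self _).trans ?_) (by positivity)
            rwa [abs_mul]
      _ = _ := by ring
  have hs₂ := Finset.sum_le_sum fun i (_ : i ∈ Finset.univ) =>
    Finset.sum_le_sum fun j (_ : j ∈ Finset.univ) => h₂ i j
  have hs₁ := Finset.sum_le_sum fun i (_ : i ∈ Finset.univ) => h₁ i
  simp only [Finset.sum_const, Finset.card_univ, Fintype.card_fin, nsmul_eq_mul] at hs₁ hs₂
  have ht : tderiv (barrier ε l T n) t x = -l * (E * r ^ (n + 2)) :=
    (barrier_hasDerivAt ε l T n t x).deriv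
  rw [Lop, ht]
  have hpos : 0 < E * r ^ (n + 2) := by positivity
  nlinarith [mul_lt_mul_of_pos_right hl hpos]

theorem add_barrier_nonneg_of_le_norm {d : ℕ} {K q ε l T t : ℝ} {n : ℕ} {v : ℝ} {x : Vec d}
    (hK : 0 ≤ K) (hqn : q ≤ n) (hε : 0 < ε) (hl : 0 ≤ l) (ht : t ≤ T)
    (hv : |v| ≤ K * (1 + ‖x‖ ^ q)) (hx₁ : 1 ≤ ‖x‖) (hx : 2 * K / ε ≤ ‖x‖) :
    0 ≤ v + barrier ε l T n t x := by
  have hx0 := norm_nonneg x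
  have hpow : ‖x‖ ^ q ≤ ‖x‖ ^ n := by
    rw [← Real.rpow_natCast]
    exact Real.rpow_le_rpow_of_exponent_le hx₁ hqn
  have hone : 1 ≤ ‖x‖ ^ n := one_le_pow₀ hx₁
  have hKx : 2 * K ≤ ε * ‖x‖ := by rwa [div_le_iff₀' hε] at hx
  have hbar : ε * (‖x‖ * ‖x‖ ^ n) ≤ barrier ε l T n t x := by
    have hexp : 1 ≤ Real.exp (l * (T - t)) :=
      Real.one_le_exp (mul_nonneg hl (sub_nonneg.2 ht))
    have hr : ‖x‖ ≤ 1 + ‖x‖ ^ 2 := by nlinarith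
    calc ε * (‖x‖ * ‖x‖ ^ n) = ε * 1 * ‖x‖ ^ (n + 1) := by ring
      _ ≤ ε * Real.exp (l * (T - t)) * (1 + ‖x‖ ^ 2) ^ (n + 1) := by gcongr
      _ ≤ _ := by
        unfold barrier
        gcongr
        · nlinarith
        · omega
  nlinarith [neg_abs_le v, mul_le_mul_of_nonneg_left (add_le_add hone hpow) hK,
    mul_le_mul_of_nonneg_right hKx (by positivity : 0 ≤ ‖x‖ ^ n)]

/-- A function on a closed strip, nonnegative outside a ball and negative somewhere, attains a
negative minimum. -/
theorem exists_neg_isMin_strip {d : ℕ} {T R : ℝ} {g : ℝ → Vec d → ℝ}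
    (hg : ContinuousOn (fun p : ℝ × Vec d => g p.1 p.2) (Set.Icc 0 T ×ˢ Set.univ))
    (hout : ∀ t ∈ Set.Icc 0 T, ∀ x, R ≤ ‖x‖ → 0 ≤ g t x)
    {t₁ : ℝ} (ht₁ : t₁ ∈ Set.Icc 0 T) {x₁ : Vec d} (hneg : g t₁ x₁ < 0) :
    ∃ t₀ ∈ Set.Icc 0 T, ∃ x₀, g t₀ x₀ < 0 ∧ ∀ t ∈ Set.Icc 0 T, ∀ x, g t₀ x₀ ≤ g t x := by
  have hin : ∀ t ∈ Set.Icc 0 T, ∀ x, g t x < 0 → x ∈ Metric.closedBall (0 : Vec d) R :=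
    fun t ht x hx => by
      by_contra hR
      rw [mem_closedBall_zero_iff, not_le] at hR
      exact (hout t ht x hR.le).not_gt hx
  obtain ⟨⟨t₀, x₀⟩, ⟨ht₀, -⟩, hmin⟩ :=
    (isCompact_Icc.prod (isCompact_closedBall (0 : Vec d) R)).exists_isMinOn
      ⟨(t₁, x₁), ht₁, hin t₁ ht₁ x₁ hneg⟩
      (hg.mono (Set.prod_mono subset_rfl (Set.subset_univ _)))
  have hle : g t₀ x₀ ≤ g t₁ x₁ := hmin (Set.mk_mem_prod ht₁ (hin t₁ ht₁ x₁ hneg))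
  refine ⟨t₀, ht₀, x₀, hle.trans_lt hneg, fun t ht x => ?_⟩
  by_cases hx : g t x < 0
  · exact hmin (Set.mk_mem_prod ht (hin t ht x hx))
  · linarith

/-- comparison principle for terminal-value parabolic inequalities with
nonnegative zero-order coefficient on ℝ^d: Let `(a_{ij}(t,x))` be symmetric positive
semidefinite with quadratic growth, `b_i` with linear growth, `γ ≥ 0`, and let
`u ∈ C^{1,2}([0,T]×ℝ^d)` have polynomial growth, satisfy `ℒu − γ·u ≤ 0` on
`[0,T)×ℝ^d` and `u(T,·) ≥ 0`.  Then `u ≥ 0` on `[0,T]×ℝ^d`. -/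
theorem comparison_principle_polynomial_growth
    (T : ℝ) (hT : 0 < T) (d : ℕ)
    (A : ℝ → Vec d → Fin d → Fin d → ℝ) (B : ℝ → Vec d → Fin d → ℝ)
    (hAsymm : ∀ t x i j, A t x i j = A t x j i)
    (hApsd : ∀ (t : ℝ) (x : Vec d) (ξ : Fin d → ℝ),
      0 ≤ ∑ i, ∑ j, A t x i j * ξ i * ξ j)
    (c₁ d₁ c₂ d₂ : ℝ) (hc₁ : 0 < c₁) (hd₁ : 0 < d₁) (hc₂ : 0 < c₂) (hd₂ : 0 < d₂)
    (hAgrowth : ∀ t ∈ Set.Icc (0 : ℝ) T, ∀ (x : Vec d) (i j : Fin d),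
      |A t x i j| ≤ c₂ * ‖x‖ ^ 2 + d₂)
    (hBgrowth : ∀ t ∈ Set.Icc (0 : ℝ) T, ∀ (x : Vec d) (i : Fin d),
      |B t x i| ≤ c₁ * ‖x‖ + d₁)
    (γ : ℝ → Vec d → ℝ) (hγ : ∀ (t : ℝ) (x : Vec d), 0 ≤ γ t x)
    (u : ℝ → Vec d → ℝ) (huC12 : C12 T u)
    (K q : ℝ) (hK : 0 < K) (hq : 0 ≤ q)
    (hugrowth : ∀ t ∈ Set.Icc (0 : ℝ) T, ∀ x : Vec d, |u t x| ≤ K * (1 + ‖x‖ ^ q))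
    (hineq : ∀ t ∈ Set.Ico (0 : ℝ) T, ∀ x : Vec d,
      Lop A B u t x - γ t x * u t x ≤ 0)
    (huT : ∀ x : Vec d, 0 ≤ u T x) :
    ∀ t ∈ Set.Icc (0 : ℝ) T, ∀ x : Vec d, 0 ≤ u t x := by
  obtain ⟨hcont, htd, hxd, -⟩ := huC12
  by_contra! hcon
  obtain ⟨t₁, ht₁, x₁, hneg⟩ := hcon
  obtain ⟨n, hqn⟩ := exists_nat_ge q
  obtain ⟨l, hl⟩ : ∃ l : ℝ, d * (d * ((c₂ + d₂) * (2 * (n + 2) * (2 * (n + 1) + 1)))) +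
      d * ((c₁ + d₁) * (2 * (n + 2))) < l := exists_gt _
  have hl0 : 0 ≤ l := le_trans (by positivity) hl.le
  obtain ⟨ε, hε, hεneg⟩ : ∃ ε > 0, u t₁ x₁ + barrier ε l T n t₁ x₁ < 0 := by
    have hb : 0 < barrier 1 l T n t₁ x₁ := by unfold barrier; positivity
    refine ⟨-u t₁ x₁ / (2 * barrier 1 l T n t₁ x₁), div_pos (by linarith) (by positivity), ?_⟩
    have hscale : ∀ ε, barrier ε l T n t₁ x₁ = ε * barrier 1 l T n t₁ x₁ := fun ε => by
      unfold barrier; ring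
    rw [hscale]
    have : -u t₁ x₁ / (2 * barrier 1 l T n t₁ x₁) * barrier 1 l T n t₁ x₁ = -u t₁ x₁ / 2 := by
      field_simp
    linarith
  obtain ⟨t₀, ht₀, x₀, hneg₀, hmin⟩ := exists_neg_isMin_strip
    (g := fun t x => u t x + barrier ε l T n t x) (R := max 1 (2 * K / ε))
    (hcont.add (barrier_continuous ε l T n).continuousOn)
    (fun t ht x hx => add_barrier_nonneg_of_le_norm hK.le hqn hε hl0 ht.2
      (hugrowth t ht x) ((le_max_left _ _).trans hx) ((le_max_right _ _).trans hx))
    ht₁ hεneg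
  have hb₀ : 0 < barrier ε l T n t₀ x₀ := by unfold barrier; positivity
  have htT : t₀ < T := by
    refine ht₀.2.lt_of_ne fun h => ?_
    subst h
    linarith [huT x₀]
  have hbt := (barrier_hasDerivAt ε l T n t₀ x₀).differentiableAt
  have hLg : 0 ≤ Lop A B (fun t x => u t x + barrier ε l T n t x) t₀ x₀ :=
    Lop_nonneg_of_isLocalMin (hAsymm t₀ x₀) (hApsd t₀ x₀)
      ((hxd t₀ ht₀).add (barrier_contDiff ε l T n t₀))
      (Filter.Eventually.of_forall fun x => hmin t₀ ht₀ x)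
      (deriv_nonneg_of_isMinOn_Icc htT
        (fun t ht => hmin t ⟨ht₀.1.trans ht.1, ht.2⟩ x₀) ((htd x₀ t₀ ht₀).add hbt))
  rw [Lop_add A B (htd x₀ t₀ ht₀) hbt (hxd t₀ ht₀) (barrier_contDiff ε l T n t₀)] at hLg
  have hLb : Lop A B (barrier ε l T n) t₀ x₀ < 0 :=
    Lop_barrier_neg hc₁.le hd₁.le hc₂.le hd₂.le (hAgrowth t₀ ht₀ x₀) (hBgrowth t₀ ht₀ x₀)
      T n hε hl
  nlinarith [hineq t₀ ⟨ht₀.1, htT⟩ x₀, hγ t₀ x₀]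

end
end
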